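/- Assume (H0), (H1) and (H2). Then for every ν₀ ∈ P(E) there exists a unique family (ν_t)_{t≥0} of probability measures on E with ν_0 = ν₀ such that t ↦ ν_t is Lipschitz continuous for the total variation norm and, for every t ≥ 0 and every Borel set A ⊆ E, ν_t(A) = ν₀(A) + ∫₀ᵗ (Π_{ν_s}(A) − ν_s(A)) ds; i.e., the ordinary differential equation dν/dt = −ν + Π_ν on P(E) admits a unique solution from every initial condition. -/

import Mathlib

open MeasureTheory Filter Topology
open scoped ENNReal NNReal

noncomputable section

namespace QSD

variable {E : Type*}

/-- `n`-fold iterate of a sub-Markov kernel given as a measure-valued map: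
`kIter K 0 x = δ_x` and `kIter K (n+1) x = (K x).bind (kIter K n)`. -/
def kIter [MeasurableSpace E] (K : E → Measure E) : ℕ → E → Measure E
  | 0, x => Measure.dirac x
  | n + 1, x => (K x).bind (kIter K n)

/-- Total variation distance between two measures: supremum over measurable sets
of the absolute difference of the masses. -/
def tvDist [MeasurableSpace E] (μ ν : Measure E) : ℝ :=
  ⨆ A : {s : Set E // MeasurableSet s}, |(μ (A : Set E)).toReal - (ν (A : Set E)).toReal|

/-- The kernel `A_μ(x,·) = Σ_{n≥0} K_{μ,∂}^n(x,·)`. -/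
def Aker [MeasurableSpace E] (K : E → Measure E) (x : E) : Measure E :=
  Measure.sum fun n => kIter K n x

/-- `Π_μ = μ A_μ / (μ A_μ)(E)`. -/
def Pim [MeasurableSpace E] (K : E → Measure E) (μ : Measure E) : Measure E :=
  ((μ.bind (Aker K)) Set.univ)⁻¹ • μ.bind (Aker K)

/-- The kernel with redistribution (rebirth) `𝕂_μ(x,·) = K_{μ,∂}(x,·) + δ_μ(x)·μ(·)`,
where `δ_μ(x) = 1 - K_{μ,∂}(x,E)`. -/
def Kret [MeasurableSpace E] (K : E → Measure E) (μ : Measure E) (x : E) : Measure E :=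
  K x + (1 - K x Set.univ) • μ

/-- Iterated application of a family of kernels to the constant function `𝟙`:
`chainV K [μ₁,…,μ_k] x = (K_{μ₁}(K_{μ₂}(⋯(K_{μ_k} 𝟙)⋯)))(x)`. -/
def chainV {V : Type*} [MeasurableSpace V] {I : Type*} (K : I → V → Measure V) :
    List I → V → ℝ≥0∞
  | [], _ => 1
  | μ :: L, x => ∫⁻ y, chainV K L y ∂(K μ x)

end QSD

open QSD

/-- `ν : ℝ → P(E)` is a solution of the measure-valued ODE `dν/dt = −ν + Π_ν`
starting from `ν₀`: it starts at `ν₀`, is Lipschitz in total variation on `[0,∞)`, and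
satisfies the integral equation `ν_t(A) = ν₀(A) + ∫₀ᵗ (Π_{ν_s}(A) − ν_s(A)) ds`. -/
def IsODESol {E : Type*} [MeasurableSpace E]
    (K : ProbabilityMeasure E → E → Measure E)
    (ν₀ : ProbabilityMeasure E) (ν : ℝ → ProbabilityMeasure E) : Prop :=
  ν 0 = ν₀ ∧
  (∃ L : ℝ, ∀ s t : ℝ, 0 ≤ s → 0 ≤ t →
    tvDist (ν s : Measure E) (ν t : Measure E) ≤ L * |s - t|) ∧
  ∀ t : ℝ, 0 ≤ t → ∀ A : Set E, MeasurableSet A →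
    ((ν t : Measure E) A).toReal = ((ν₀ : Measure E) A).toReal +
      ∫ s in Set.Ioc (0 : ℝ) t,
        ((Pim (K (ν s)) (ν s : Measure E) A).toReal - ((ν s : Measure E) A).toReal)

section BanachODE

lemma continuous_comp_of_lipschitz {X : Type*} [NormedAddCommGroup X] {P : X → X} {S : Set X} {L : ℝ}
    (hP : ∀ x ∈ S, ∀ y ∈ S, ‖P x - P y‖ ≤ L * ‖x - y‖) {u : ℝ → X} (hu : Continuous u)
    (huS : ∀ s, u s ∈ S) : Continuous fun s => P (u s) := by
  have h : LipschitzOnWith L.toNNReal P S := LipschitzOnWith.of_dist_le_mul fun x hx y hy => by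
    rw [dist_eq_norm, dist_eq_norm]
    exact (hP x hx y hy).trans (by gcongr; exact Real.le_coe_toNNReal L)
  exact h.continuousOn.comp_continuous hu huS

variable {X : Type*} [NormedAddCommGroup X] [NormedSpace ℝ X]

/-- The map whose fixed points are the mild solutions of `u' = P u - u`, `u 0 = x₀` on `[0, ∞)`,
extended by a constant to negative times. -/
def mildStep (P : X → X) (x₀ : X) (u : ℝ → X) (t : ℝ) : X :=
  Real.exp (-max t 0) • (x₀ + ∫ s in (0 : ℝ)..max t 0, Real.exp s • P (u s))

lemma continuous_mildStep {P : X → X} (x₀ : X) {u : ℝ → X} (hPu : Continuous fun s => P (u s)) :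
    Continuous (mildStep P x₀ u) := by
  have h : Continuous fun t : ℝ => ∫ s in (0 : ℝ)..t, Real.exp s • P (u s) :=
    intervalIntegral.continuous_primitive
      (fun a b => (Real.continuous_exp.smul hPu).intervalIntegrable a b) 0
  have h' : Continuous fun t : ℝ => ∫ s in (0 : ℝ)..max t 0, Real.exp s • P (u s) :=
    h.comp (by fun_prop)
  unfold mildStep
  fun_prop

lemma norm_mildStep_sub_le {P : X → X} {S : Set X} {L : ℝ} (hL : 0 < L)
    (hP : ∀ x ∈ S, ∀ y ∈ S, ‖P x - P y‖ ≤ L * ‖x - y‖) (x₀ : X) {u v : ℝ → X}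
    (hPu : Continuous fun s => P (u s)) (hPv : Continuous fun s => P (v s))
    (huS : ∀ s, u s ∈ S) (hvS : ∀ s, v s ∈ S) {c : ℝ} (hc : 0 ≤ c)
    (huv : ∀ t, ‖u t - v t‖ ≤ c * Real.exp (2 * L * max t 0)) (t : ℝ) :
    ‖mildStep P x₀ u t - mildStep P x₀ v t‖ ≤ c / 2 * Real.exp (2 * L * max t 0) := by
  unfold mildStep
  set τ := max t 0
  have hτ : 0 ≤ τ := le_max_right _ _
  have hcont : ∀ {f : ℝ → X}, Continuous f → Continuous fun s => Real.exp s • f s :=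
    fun hf => Real.continuous_exp.smul hf
  rw [← smul_sub, add_sub_add_left_eq_sub, ← intervalIntegral.integral_sub
    (hcont hPu |>.intervalIntegrable _ _) (hcont hPv |>.intervalIntegrable _ _),
    ← intervalIntegral.integral_smul]
  have hbd := intervalIntegral.norm_integral_le_of_norm_le (μ := volume) hτ
    (f := fun s => Real.exp (-τ) • (Real.exp s • P (u s) - Real.exp s • P (v s)))
    (g := fun s => L * c * Real.exp (2 * L * s)) (Eventually.of_forall fun s hs => by
      rw [← smul_sub, ← mul_smul, norm_smul, ← Real.exp_add, Real.norm_eq_abs, Real.abs_exp]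
      have h1 : Real.exp (-τ + s) ≤ 1 := Real.exp_le_one_iff.mpr (by linarith [hs.2])
      have h2 := hP _ (huS s) _ (hvS s)
      have h3 := huv s
      rw [max_eq_left hs.1.le] at h3
      calc Real.exp (-τ + s) * ‖P (u s) - P (v s)‖ ≤ 1 * ‖P (u s) - P (v s)‖ := by gcongr
        _ ≤ L * ‖u s - v s‖ := by rw [one_mul]; exact h2
        _ ≤ L * (c * Real.exp (2 * L * s)) := by gcongr
        _ = _ := by ring) (Continuous.intervalIntegrable (by fun_prop) _ _)
  refine hbd.trans ?_
  have h2L : 2 * L ≠ 0 := by positivity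
  rw [intervalIntegral.integral_const_mul, intervalIntegral.integral_comp_mul_left _ h2L,
    integral_exp, mul_zero, Real.exp_zero, smul_eq_mul]
  have : L * c * ((2 * L)⁻¹ * (Real.exp (2 * L * τ) - 1))
      = c / 2 * (Real.exp (2 * L * τ) - 1) := by field_simp
  rw [this]
  gcongr
  linarith

variable [CompleteSpace X]

lemma mild_average_mem {S : Set X} (hconv : Convex ℝ S) (hcl : IsClosed S) {x₀ : X}
    (hx₀ : x₀ ∈ S) {g : ℝ → X} (hg : Continuous g) (hgS : ∀ s, g s ∈ S) {t : ℝ} (ht : 0 ≤ t) :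
    Real.exp (-t) • (x₀ + ∫ s in (0 : ℝ)..t, Real.exp s • g s) ∈ S := by
  classical
  let w : ℝ → ℝ≥0∞ := fun s => ENNReal.ofReal (Real.exp (-t) * Real.exp s)
  have hw : Measurable w := by fun_prop
  have hw_top : ∀ᵐ s ∂(volume.restrict (Set.Ioc 0 t)), w s < ⊤ :=
    Eventually.of_forall fun s => ENNReal.ofReal_lt_top
  let m₁ : Measure ℝ := (volume.restrict (Set.Ioc 0 t)).withDensity w
  let m : Measure ℝ := ENNReal.ofReal (Real.exp (-t)) • Measure.dirac 0 + m₁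
  let f : ℝ → X := fun s => if s ≤ 0 then x₀ else g s
  have hw_real : ∀ s, (w s).toReal = Real.exp (-t) * Real.exp s := fun s =>
    ENNReal.toReal_ofReal (by positivity)
  have hf_eq : ∀ᵐ s ∂(volume.restrict (Set.Ioc 0 t)),
      (w s).toReal • f s = Real.exp (-t) • Real.exp s • g s := by
    filter_upwards [ae_restrict_mem measurableSet_Ioc] with s hs
    rw [hw_real, mul_smul]
    simp [f, not_le.mpr hs.1]
  have hint : Integrable (fun s => Real.exp (-t) • Real.exp s • g s)
      (volume.restrict (Set.Ioc 0 t)) :=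
    (Continuous.integrableOn_Icc (by fun_prop)).mono_set Set.Ioc_subset_Icc_self
  have hf₁ : Integrable f m₁ := by
    rw [integrable_withDensity_iff_integrable_smul' hw hw_top]
    exact hint.congr (hf_eq.mono fun s hs => hs.symm)
  have hf₀ : Integrable f (ENNReal.ofReal (Real.exp (-t)) • Measure.dirac 0) :=
    (integrable_dirac (by simp)).smul_measure ENNReal.ofReal_ne_top
  have hm₁ : m₁ Set.univ = ENNReal.ofReal (1 - Real.exp (-t)) := by
    rw [withDensity_apply _ MeasurableSet.univ, Measure.restrict_univ,
      ← ofReal_integral_eq_lintegral_ofReal, ← intervalIntegral.integral_of_le ht,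
      intervalIntegral.integral_const_mul, integral_exp, mul_sub, ← Real.exp_add]
    · simp
    · exact (Continuous.integrableOn_Icc (by fun_prop)).mono_set Set.Ioc_subset_Icc_self
    · exact Eventually.of_forall fun s => by positivity
  have : IsProbabilityMeasure m := ⟨by
    have h1 : Real.exp (-t) ≤ 1 := Real.exp_le_one_iff.mpr (by linarith)
    simp only [m, Measure.add_apply, Measure.smul_apply, hm₁, measure_univ, smul_eq_mul, mul_one]
    rw [← ENNReal.ofReal_add (by positivity) (by linarith)]
    simp⟩
  have key : ∫ s, f s ∂m = Real.exp (-t) • (x₀ + ∫ s in (0 : ℝ)..t, Real.exp s • g s) := by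
    rw [integral_add_measure hf₀ hf₁, integral_smul_measure, integral_dirac,
      integral_withDensity_eq_integral_toReal_smul hw hw_top, integral_congr_ae hf_eq,
      integral_smul, ← intervalIntegral.integral_of_le ht, smul_add,
      ENNReal.toReal_ofReal (Real.exp_pos _).le]
    simp [f]
  rw [← key]
  refine hconv.integral_mem hcl (Eventually.of_forall fun s => ?_) (hf₀.add_measure hf₁)
  by_cases hs : s ≤ 0 <;> simp [f, hs, hx₀, hgS]

lemma exists_mild_solution {P : X → X} {S : Set X} (hconv : Convex ℝ S) (hcl : IsClosed S)
    {R : ℝ} (hR : ∀ x ∈ S, ‖x‖ ≤ R) {L : ℝ} (hL : 0 < L)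
    (hP : ∀ x ∈ S, ∀ y ∈ S, ‖P x - P y‖ ≤ L * ‖x - y‖) (hPS : ∀ x ∈ S, P x ∈ S)
    {x₀ : X} (hx₀ : x₀ ∈ S) :
    ∃ u : ℝ → X, Continuous u ∧ (∀ t, u t ∈ S) ∧ mildStep P x₀ u = u := by
  have hR0 : 0 ≤ R := (norm_nonneg _).trans (hR _ hx₀)
  let u : ℕ → ℝ → X := fun n => (mildStep P x₀)^[n] fun _ => x₀
  have hsucc : ∀ n, u (n + 1) = mildStep P x₀ (u n) := fun n =>
    Function.iterate_succ_apply' _ _ _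
  have hstepS : ∀ {v : ℝ → X}, Continuous v → (∀ t, v t ∈ S) → ∀ t, mildStep P x₀ v t ∈ S :=
    fun hv hvS t => mild_average_mem hconv hcl hx₀ (continuous_comp_of_lipschitz hP hv hvS)
      (fun s => hPS _ (hvS s)) (le_max_right _ _)
  have hu : ∀ n, Continuous (u n) ∧ ∀ t, u n t ∈ S := by
    intro n
    induction n with
    | zero => exact ⟨continuous_const, fun _ => hx₀⟩
    | succ n ih =>
      rw [hsucc]
      exact ⟨continuous_mildStep x₀ (continuous_comp_of_lipschitz hP ih.1 ih.2),
        hstepS ih.1 ih.2⟩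
  have hPu : ∀ n, Continuous fun s => P (u n s) := fun n =>
    continuous_comp_of_lipschitz hP (hu n).1 (hu n).2
  have hdiff : ∀ n t, ‖u n t - u (n + 1) t‖
      ≤ 2 * R * (1 / 2) ^ n * Real.exp (2 * L * max t 0) := by
    intro n
    induction n with
    | zero =>
      intro t
      have h1 : 1 ≤ Real.exp (2 * L * max t 0) := Real.one_le_exp (by positivity)
      have h2 := norm_sub_le (u 0 t) (u (0 + 1) t)
      have h3 := hR _ ((hu 0).2 t)
      have h4 := hR _ ((hu (0 + 1)).2 t)
      nlinarith
    | succ n ih =>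
      intro t
      have h := norm_mildStep_sub_le hL hP x₀ (hPu n) (hPu (n + 1)) (hu n).2 (hu (n + 1)).2
        (by positivity) ih t
      rw [← hsucc, ← hsucc] at h
      refine h.trans (le_of_eq ?_)
      ring
  have hgeom : ∀ t n, dist (u n t) (u (n + 1) t)
      ≤ 2 * R * Real.exp (2 * L * max t 0) * (1 / 2) ^ n := fun t n => by
    rw [dist_eq_norm]
    exact (hdiff n t).trans (le_of_eq (by ring))
  choose v hv using fun t =>
    cauchySeq_tendsto_of_complete (cauchySeq_of_le_geometric _ _ (by norm_num) (hgeom t))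
  have hrate : ∀ n t, ‖u n t - v t‖ ≤ 4 * R * (1 / 2) ^ n * Real.exp (2 * L * max t 0) :=
    fun n t => by
      have h := dist_le_of_le_geometric_of_tendsto _ _ (by norm_num) (hgeom t) (hv t) n
      rw [dist_eq_norm] at h
      exact h.trans (le_of_eq (by ring))
  have hpow : ∀ c : ℝ, Tendsto (fun n : ℕ => 4 * R * (1 / 2) ^ n * c) atTop (𝓝 0) := fun c => by
    have h := tendsto_pow_atTop_nhds_zero_of_lt_one (r := (1 / 2 : ℝ)) (by norm_num) (by norm_num)
    simpa using (h.const_mul (4 * R)).mul_const c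
  have hvc : Continuous v := by
    have hloc : TendstoLocallyUniformly u v atTop := by
      rw [Metric.tendstoLocallyUniformly_iff]
      intro ε hε x
      refine ⟨Set.Iio (x + 1), Iio_mem_nhds (by linarith), ?_⟩
      filter_upwards [(hpow (Real.exp (2 * L * max (x + 1) 0))).eventually (gt_mem_nhds hε)]
        with n hn y hy
      rw [dist_comm, dist_eq_norm]
      refine (hrate n y).trans_lt (lt_of_le_of_lt ?_ hn)
      have : y ≤ x + 1 := (Set.mem_Iio.mp hy).le
      gcongr
    exact hloc.continuous (Frequently.of_forall fun n => (hu n).1)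
  have hvS : ∀ t, v t ∈ S := fun t =>
    hcl.mem_of_tendsto (hv t) (Eventually.of_forall fun n => (hu n).2 t)
  refine ⟨v, hvc, hvS, funext fun t => ?_⟩
  have hlim : Tendsto (fun n => u (n + 1) t) atTop (𝓝 (mildStep P x₀ v t)) := by
    rw [tendsto_iff_norm_sub_tendsto_zero]
    refine squeeze_zero (fun _ => norm_nonneg _) (fun n => ?_)
      (hpow (Real.exp (2 * L * max t 0) / 2))
    rw [hsucc]
    exact (norm_mildStep_sub_le hL hP x₀ (hPu n) (continuous_comp_of_lipschitz hP hvc hvS)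
      (hu n).2 hvS (by positivity) (hrate n) t).trans (le_of_eq (by ring))
  exact tendsto_nhds_unique hlim ((tendsto_add_atTop_iff_nat 1).mpr (hv t))

/-- Global existence for `u' = P u - u` on a bounded closed convex set preserved by the
Lipschitz map `P`. -/
lemma exists_integral_solution {P : X → X} {S : Set X} (hconv : Convex ℝ S) (hcl : IsClosed S)
    {R : ℝ} (hR : ∀ x ∈ S, ‖x‖ ≤ R) {L : ℝ} (hL : 0 < L)
    (hP : ∀ x ∈ S, ∀ y ∈ S, ‖P x - P y‖ ≤ L * ‖x - y‖) (hPS : ∀ x ∈ S, P x ∈ S)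
    {x₀ : X} (hx₀ : x₀ ∈ S) :
    ∃ u : ℝ → X, Continuous u ∧ (∀ t, u t ∈ S) ∧
      ∀ t, 0 ≤ t → u t = x₀ + ∫ s in (0 : ℝ)..t, (P (u s) - u s) := by
  obtain ⟨u, hu, huS, hfix⟩ := exists_mild_solution hconv hcl hR hL hP hPS hx₀
  have hPu : Continuous fun s => P (u s) := continuous_comp_of_lipschitz hP hu huS
  refine ⟨u, hu, huS, fun t ht => ?_⟩
  let w : ℝ → X := fun t => Real.exp (-t) • (x₀ + ∫ s in (0 : ℝ)..t, Real.exp s • P (u s))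
  have huw : ∀ s, 0 ≤ s → u s = w s := fun s hs => by
    rw [← congrFun hfix s, mildStep, max_eq_left hs]
  have hw : ∀ s, HasDerivAt w (P (u s) - w s) s := fun s => by
    have hcont : Continuous fun s => Real.exp s • P (u s) :=
      Real.continuous_exp.smul hPu
    have h1 := (intervalIntegral.integral_hasDerivAt_right
      (hcont.intervalIntegrable 0 s) (hcont.stronglyMeasurableAtFilter _ _)
      hcont.continuousAt).const_add x₀
    have h2 : HasDerivAt (fun s : ℝ => Real.exp (-s)) (-Real.exp (-s)) s := by
      simpa using (hasDerivAt_neg s).exp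
    refine (h2.smul h1).congr_deriv ?_
    rw [← mul_smul, ← Real.exp_add, neg_add_cancel, Real.exp_zero, one_smul, neg_smul,
      ← sub_eq_add_neg]
  have hwc : Continuous w := continuous_iff_continuousAt.mpr fun s => (hw s).continuousAt
  have hftc := intervalIntegral.integral_eq_sub_of_hasDerivAt (a := 0) (b := t)
    (fun s _ => hw s) ((hPu.sub hwc).intervalIntegrable _ _)
  have hw0 : w 0 = x₀ := by simp [w]
  have hcongr : ∫ s in (0 : ℝ)..t, (P (u s) - u s) = ∫ s in (0 : ℝ)..t, (P (u s) - w s) :=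
    intervalIntegral.integral_congr fun s hs => by
      rw [Set.uIcc_of_le ht] at hs
      simp only [huw s hs.1]
  rw [hcongr, hftc, hw0, huw t ht]
  abel

/-- Uniqueness for the integral form of `u' = P u - u` among curves in a set on which `P` is
Lipschitz. -/
lemma integral_solution_unique {P : X → X} {S : Set X} {L : ℝ}
    (hP : ∀ x ∈ S, ∀ y ∈ S, ‖P x - P y‖ ≤ L * ‖x - y‖) {x₀ : X} {u v : ℝ → X}
    (hu : Continuous u) (hv : Continuous v) (huS : ∀ t, u t ∈ S) (hvS : ∀ t, v t ∈ S)
    (hu_int : ∀ t, 0 ≤ t → u t = x₀ + ∫ s in (0 : ℝ)..t, (P (u s) - u s))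
    (hv_int : ∀ t, 0 ≤ t → v t = x₀ + ∫ s in (0 : ℝ)..t, (P (v s) - v s))
    {t : ℝ} (ht : 0 ≤ t) : u t = v t := by
  have hderiv : ∀ {w : ℝ → X}, Continuous w → (∀ t, w t ∈ S) →
      (∀ t, 0 ≤ t → w t = x₀ + ∫ s in (0 : ℝ)..t, (P (w s) - w s)) →
      ∀ r ∈ Set.Ico 0 t, HasDerivWithinAt w (P (w r) - w r) (Set.Ici r) r := by
    intro w hw hwS hw_int r hr
    have hcont : Continuous fun s => P (w s) - w s :=
      (continuous_comp_of_lipschitz hP hw hwS).sub hw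
    have h1 := (intervalIntegral.integral_hasDerivAt_right
      (hcont.intervalIntegrable 0 r) (hcont.stronglyMeasurableAtFilter _ _)
      hcont.continuousAt).const_add x₀
    exact h1.hasDerivWithinAt.congr (fun s hs => hw_int s (hr.1.trans hs)) (hw_int r hr.1)
  have hLip : LipschitzOnWith (L + 1).toNNReal (fun x => P x - x) S :=
    LipschitzOnWith.of_dist_le_mul fun x hx y hy => by
      rw [dist_eq_norm, dist_eq_norm]
      calc ‖P x - x - (P y - y)‖ = ‖(P x - P y) - (x - y)‖ := by congr 1; abel
        _ ≤ ‖P x - P y‖ + ‖x - y‖ := norm_sub_le _ _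
        _ ≤ (L + 1) * ‖x - y‖ := by linarith [hP x hx y hy]
        _ ≤ _ := by gcongr; exact Real.le_coe_toNNReal _
  refine ODE_solution_unique_of_mem_Icc_right (v := fun _ x => P x - x) (s := fun _ => S)
    (fun _ _ => hLip) hu.continuousOn (hderiv hu huS hu_int) (fun r _ => huS r)
    hv.continuousOn (hderiv hv hvS hv_int) (fun r _ => hvS r) ?_ (Set.right_mem_Icc.mpr ht)
  rw [hu_int 0 le_rfl, hv_int 0 le_rfl]
  simp

end BanachODE

namespace QSD

section TotalVariation

variable {E : Type*} [MeasurableSpace E]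

lemma abs_measureReal_sub_le (μ ν : Measure E) [IsFiniteMeasure μ] [IsFiniteMeasure ν]
    (A : Set E) : |μ.real A - ν.real A| ≤ μ.real Set.univ + ν.real Set.univ := by
  have h1 : μ.real A ≤ μ.real Set.univ := measureReal_mono (Set.subset_univ A)
  have h2 : ν.real A ≤ ν.real Set.univ := measureReal_mono (Set.subset_univ A)
  have h3 : 0 ≤ μ.real A := measureReal_nonneg
  have h4 : 0 ≤ ν.real A := measureReal_nonneg
  rw [abs_le]
  constructor <;> linarith

lemma abs_measureReal_sub_le_tvDist (μ ν : Measure E) [IsFiniteMeasure μ] [IsFiniteMeasure ν]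
    {A : Set E} (hA : MeasurableSet A) : |μ.real A - ν.real A| ≤ tvDist μ ν :=
  le_ciSup (f := fun A : {s : Set E // MeasurableSet s} => |μ.real (A : Set E) - ν.real A|)
    ⟨μ.real Set.univ + ν.real Set.univ, by
      rintro _ ⟨B, rfl⟩
      exact abs_measureReal_sub_le μ ν B⟩ ⟨A, hA⟩

lemma tvDist_le {μ ν : Measure E} {c : ℝ}
    (h : ∀ A, MeasurableSet A → |μ.real A - ν.real A| ≤ c) : tvDist μ ν ≤ c :=
  haveI : Nonempty {s : Set E // MeasurableSet s} := ⟨⟨∅, MeasurableSet.empty⟩⟩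
  ciSup_le fun A => h A A.2

lemma abs_integral_sub_le_tvDist (μ ν : Measure E) [IsFiniteMeasure μ] [IsFiniteMeasure ν]
    {f : E → ℝ} (hf : Measurable f) (hf0 : ∀ x, 0 ≤ f x) {M : ℝ} (hM : 0 ≤ M)
    (hfM : ∀ x, f x ≤ M) : |∫ x, f x ∂μ - ∫ x, f x ∂ν| ≤ M * tvDist μ ν := by
  have hint : ∀ (m : Measure E) [IsFiniteMeasure m], Integrable f m := fun m _ =>
    Integrable.of_bound hf.aestronglyMeasurable M (Eventually.of_forall fun x => by
      rw [Real.norm_eq_abs, abs_of_nonneg (hf0 x)]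
      exact hfM x)
  have hlayer : ∀ (m : Measure E) [IsFiniteMeasure m],
      IntegrableOn (fun t => m.real {a | t ≤ f a}) (Set.Ioc 0 M) := fun m _ => by
    have hanti : Antitone fun t => m.real {a | t ≤ f a} := fun s t hst =>
      measureReal_mono fun a (ha : t ≤ f a) => hst.trans ha
    exact (hanti.antitoneOn _).integrableOn_isCompact isCompact_Icc |>.mono_set
      Set.Ioc_subset_Icc_self
  rw [(hint μ).integral_eq_integral_Ioc_meas_le (Eventually.of_forall hf0)
      (Eventually.of_forall hfM),
    (hint ν).integral_eq_integral_Ioc_meas_le (Eventually.of_forall hf0)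
      (Eventually.of_forall hfM), ← integral_sub (hlayer μ) (hlayer ν), ← Real.norm_eq_abs]
  refine (norm_setIntegral_le_of_norm_le_const (C := tvDist μ ν) (by simp)
    fun t _ => ?_).trans (le_of_eq ?_)
  · exact abs_measureReal_sub_le_tvDist μ ν (measurableSet_le measurable_const hf)
  · rw [Real.volume_real_Ioc_of_le hM, sub_zero, mul_comm]

/-- Bounded set functions on the measurable sets of `E`, with the supremum norm. -/
abbrev SetFun (E : Type*) [MeasurableSpace E] : Type _ :=
  lp (fun _ : {s : Set E // MeasurableSet s} => ℝ) ∞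

/-- A finite measure as a bounded set function. -/
def toSetFun (μ : Measure E) [IsFiniteMeasure μ] : SetFun E :=
  ⟨fun A => μ.real (A : Set E), memℓp_infty ⟨μ.real Set.univ, by
    rintro _ ⟨A, rfl⟩
    simpa [abs_of_nonneg] using measureReal_mono (μ := μ) (Set.subset_univ (A : Set E))⟩⟩

lemma toSetFun_apply (μ : Measure E) [IsFiniteMeasure μ] (A : {s : Set E // MeasurableSet s}) :
    toSetFun μ A = μ.real (A : Set E) := rfl

lemma norm_toSetFun_sub (μ ν : Measure E) [IsFiniteMeasure μ] [IsFiniteMeasure ν] :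
    ‖toSetFun μ - toSetFun ν‖ = tvDist μ ν := by
  rw [lp.norm_eq_ciSup]
  rfl

lemma norm_toSetFun_le_one (μ : ProbabilityMeasure E) : ‖toSetFun (μ : Measure E)‖ ≤ 1 := by
  rw [lp.norm_eq_ciSup]
  refine Real.iSup_le (fun A => ?_) zero_le_one
  rw [toSetFun_apply, Real.norm_eq_abs, abs_of_nonneg measureReal_nonneg]
  exact measureReal_le_one

lemma toSetFun_injective :
    Function.Injective fun μ : ProbabilityMeasure E => toSetFun (μ : Measure E) := by
  intro μ ν h
  refine Subtype.ext (Measure.ext fun A hA => ?_)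
  have h' := congrArg (fun x : SetFun E => x ⟨A, hA⟩) h
  simp only [toSetFun_apply] at h'
  exact (ENNReal.toReal_eq_toReal_iff' (measure_ne_top (μ : Measure E) A)
    (measure_ne_top (ν : Measure E) A)).mp h'

lemma convex_range_toSetFun :
    Convex ℝ (Set.range fun μ : ProbabilityMeasure E => toSetFun (μ : Measure E)) := by
  rintro _ ⟨μ, rfl⟩ _ ⟨ν, rfl⟩ a b ha hb hab
  let m : Measure E := ENNReal.ofReal a • (μ : Measure E) + ENNReal.ofReal b • (ν : Measure E)
  have hm : IsProbabilityMeasure m := ⟨by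
    simp only [m, Measure.add_apply, Measure.smul_apply, measure_univ, smul_eq_mul, mul_one]
    rw [← ENNReal.ofReal_add ha hb, hab, ENNReal.ofReal_one]⟩
  refine ⟨⟨m, hm⟩, ?_⟩
  ext A
  change m.real A = a * (μ : Measure E).real A + b * (ν : Measure E).real A
  have h1 : IsFiniteMeasure (ENNReal.ofReal a • (μ : Measure E)) :=
    Measure.smul_finite _ ENNReal.ofReal_ne_top
  have h2 : IsFiniteMeasure (ENNReal.ofReal b • (ν : Measure E)) :=
    Measure.smul_finite _ ENNReal.ofReal_ne_top
  rw [measureReal_add_apply, measureReal_ennreal_smul_apply, measureReal_ennreal_smul_apply,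
    ENNReal.toReal_ofReal ha, ENNReal.toReal_ofReal hb]

lemma isClosed_range_toSetFun :
    IsClosed (Set.range fun μ : ProbabilityMeasure E => toSetFun (μ : Measure E)) := by
  refine IsSeqClosed.isClosed fun y x hy hyx => ?_
  choose μ hμ using hy
  obtain rfl : (fun n => toSetFun (μ n : Measure E)) = y := funext hμ
  have hrate : ∀ n A, |(μ n : Measure E).real A.1 - x A| ≤ ‖toSetFun (μ n : Measure E) - x‖ :=
    fun n A => lp.norm_apply_le_norm ENNReal.top_ne_zero (toSetFun (μ n : Measure E) - x) A
  have hnorm := tendsto_iff_norm_sub_tendsto_zero.mp hyx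
  have hlim : ∀ A, Tendsto (fun n => (μ n : Measure E).real A.1) atTop (𝓝 (x A)) := fun A =>
    tendsto_iff_norm_sub_tendsto_zero.mpr
      (squeeze_zero (fun _ => norm_nonneg _) (fun n => hrate n A) hnorm)
  have hnonneg : ∀ A, 0 ≤ x A := fun A =>
    ge_of_tendsto' (hlim A) fun _ => measureReal_nonneg
  have hempty : x ⟨∅, MeasurableSet.empty⟩ = 0 :=
    tendsto_nhds_unique (hlim _) (by simp)
  have huniv : x ⟨Set.univ, MeasurableSet.univ⟩ = 1 :=
    tendsto_nhds_unique (hlim _) (by simp)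
  have hsum : ∀ (f : ℕ → Set E) (hf : ∀ i, MeasurableSet (f i)),
      Pairwise (Function.onFun Disjoint f) →
      HasSum (fun i => x ⟨f i, hf i⟩) (x ⟨⋃ i, f i, MeasurableSet.iUnion hf⟩) := by
    intro f hf hdisj
    have hfin : ∀ n (s : Finset ℕ), |(μ n : Measure E).real (⋃ i ∈ s, f i)
        - ∑ i ∈ s, x ⟨f i, hf i⟩| ≤ ‖toSetFun (μ n : Measure E) - x‖ := by
      intro n s
      have hs : MeasurableSet (⋃ i ∈ s, f i) := s.measurableSet_biUnion fun i _ => hf i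
      have heq : x ⟨⋃ i ∈ s, f i, hs⟩ = ∑ i ∈ s, x ⟨f i, hf i⟩ := by
        refine tendsto_nhds_unique (hlim _) ?_
        have h := tendsto_finsetSum s fun i _ => hlim ⟨f i, hf i⟩
        refine h.congr fun k => ?_
        exact (measureReal_biUnion_finset (fun i _ j _ hij => hdisj hij) fun i _ => hf i).symm
      rw [← heq]
      exact hrate n ⟨_, hs⟩
    have hunif : TendstoUniformly (fun n (s : Finset ℕ) => (μ n : Measure E).real (⋃ i ∈ s, f i))
        (fun s => ∑ i ∈ s, x ⟨f i, hf i⟩) atTop := by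
      rw [Metric.tendstoUniformly_iff]
      intro ε hε
      filter_upwards [hnorm.eventually (gt_mem_nhds hε)] with n hn s
      rw [dist_comm, Real.dist_eq]
      exact (hfin n s).trans_lt hn
    refine hunif.tendsto_of_eventually_tendsto (Eventually.of_forall fun n => ?_)
      (hlim ⟨⋃ i, f i, MeasurableSet.iUnion hf⟩)
    have h : HasSum (fun i => (μ n : Measure E).real (f i))
        ((μ n : Measure E).real (⋃ i, f i)) := by
      have hne : ∑' i, (μ n : Measure E) (f i) ≠ ⊤ := by
        rw [← measure_iUnion hdisj hf]
        exact measure_ne_top _ _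
      rw [measureReal_def, measure_iUnion hdisj hf,
        ENNReal.tsum_toReal_eq fun i => measure_ne_top _ _]
      exact (ENNReal.summable_toReal hne).hasSum
    refine Tendsto.congr (fun s => ?_) h
    exact (measureReal_biUnion_finset (fun i _ j _ hij => hdisj hij) fun i _ => hf i).symm
  let m : Measure E := Measure.ofMeasurable (fun A hA => ENNReal.ofReal (x ⟨A, hA⟩))
    (by rw [hempty, ENNReal.ofReal_zero]) fun f hf hdisj => by
      rw [← (hsum f hf hdisj).tsum_eq,
        ENNReal.ofReal_tsum_of_nonneg (fun i => hnonneg _) (hsum f hf hdisj).summable]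
  have hm : ∀ A (hA : MeasurableSet A), m A = ENNReal.ofReal (x ⟨A, hA⟩) := fun A hA =>
    Measure.ofMeasurable_apply A hA
  have hprob : IsProbabilityMeasure m := ⟨by
    rw [hm _ MeasurableSet.univ, huniv, ENNReal.ofReal_one]⟩
  refine ⟨⟨m, hprob⟩, ?_⟩
  ext A
  change (m A).toReal = x A
  rw [hm _ A.2, ENNReal.toReal_ofReal (hnonneg _)]

end TotalVariation

section Resolvent

variable {E : Type*} [MeasurableSpace E] {K : E → Measure E}

lemma measurable_kIter (hK : Measurable K) (n : ℕ) : Measurable (kIter K n) := by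
  induction n with
  | zero => exact Measure.measurable_dirac
  | succ n ih => exact (Measure.measurable_bind' ih).comp hK

lemma measurable_Aker (hK : Measurable K) : Measurable (Aker K) := by
  refine Measure.measurable_of_measurable_coe _ fun A hA => ?_
  simp only [Aker, Measure.sum_apply _ hA]
  exact Measurable.tsum fun n =>
    (Measure.measurable_coe hA).comp (measurable_kIter hK n)

lemma kIter_add (hK : Measurable K) (m n : ℕ) (x : E) :
    kIter K (m + n) x = (kIter K m x).bind (kIter K n) := by
  induction m generalizing x with
  | zero => rw [zero_add, kIter, Measure.dirac_bind (measurable_kIter hK n)]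
  | succ m ih =>
    rw [Nat.add_right_comm, kIter, kIter, Measure.bind_bind
      (measurable_kIter hK m).aemeasurable (measurable_kIter hK n).aemeasurable]
    congr 1
    exact funext ih

lemma kIter_one (K : E → Measure E) : kIter K 1 = K := by
  funext x
  exact Measure.bind_dirac

lemma kIter_add_univ_le (hK : Measurable K) {m n : ℕ} {a b : ℝ≥0∞}
    (hm : ∀ x, kIter K m x Set.univ ≤ a) (hn : ∀ x, kIter K n x Set.univ ≤ b) (x : E) :
    kIter K (m + n) x Set.univ ≤ a * b := by
  rw [kIter_add hK, Measure.bind_apply MeasurableSet.univ (measurable_kIter hK n).aemeasurable]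
  calc ∫⁻ y, kIter K n y Set.univ ∂kIter K m x ≤ ∫⁻ _, b ∂kIter K m x := lintegral_mono hn
    _ = b * kIter K m x Set.univ := lintegral_const _
    _ ≤ b * a := by gcongr; exact hm x
    _ = a * b := mul_comm _ _

lemma kIter_univ_le_one (hK : Measurable K) (hsub : ∀ x, K x Set.univ ≤ 1) (n : ℕ) (x : E) :
    kIter K n x Set.univ ≤ 1 := by
  induction n generalizing x with
  | zero => simp [kIter]
  | succ n ih =>
    simpa using kIter_add_univ_le hK (m := n) (n := 1) ih (by simpa [kIter_one] using hsub) x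

lemma kIter_univ_le_pow (hK : Measurable K) (hsub : ∀ x, K x Set.univ ≤ 1) {ℓ : ℕ} {ρ : ℝ≥0∞}
    (hρ : ∀ x, kIter K ℓ x Set.univ ≤ ρ) (j i : ℕ) (x : E) :
    kIter K (ℓ * j + i) x Set.univ ≤ ρ ^ j := by
  induction j generalizing x with
  | zero => simpa using kIter_univ_le_one hK hsub i x
  | succ j ih =>
    have h := kIter_add_univ_le hK hρ ih x
    rwa [← add_assoc, add_comm ℓ, ← Nat.mul_succ, ← pow_succ'] at h

lemma Aker_univ_le (hK : Measurable K) (hsub : ∀ x, K x Set.univ ≤ 1) {ℓ : ℕ} (hℓ : 1 ≤ ℓ)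
    {ρ : ℝ≥0∞} (hρ : ∀ x, kIter K ℓ x Set.univ ≤ ρ) (x : E) :
    Aker K x Set.univ ≤ ℓ * (1 - ρ)⁻¹ := by
  have : NeZero ℓ := ⟨by omega⟩
  rw [Aker, Measure.sum_apply _ MeasurableSet.univ]
  calc ∑' n, kIter K n x Set.univ ≤ ∑' n, ρ ^ (n / ℓ) := ENNReal.tsum_le_tsum fun n => by
        conv_lhs => rw [← Nat.div_add_mod n ℓ]
        exact kIter_univ_le_pow hK hsub hρ _ _ x
    _ = ∑' p : ℕ × Fin ℓ, ρ ^ p.1 := by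
        rw [← (Nat.divModEquiv ℓ).tsum_eq]
        rfl
    _ = ℓ * (1 - ρ)⁻¹ := by
        rw [ENNReal.tsum_prod', ← ENNReal.tsum_geometric, ← ENNReal.tsum_mul_left]
        simp

lemma one_le_Aker_univ (K : E → Measure E) (x : E) : 1 ≤ Aker K x Set.univ := by
  rw [Aker, Measure.sum_apply _ MeasurableSet.univ]
  exact le_trans (by simp [kIter]) (ENNReal.le_tsum (f := fun n => kIter K n x Set.univ) 0)

lemma Aker_apply_eq (hK : Measurable K) {B : Set E} (hB : MeasurableSet B) (x : E) :
    Aker K x B = Measure.dirac x B + ∫⁻ y, Aker K y B ∂K x := by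
  have hmeas : ∀ n, Measurable fun y => kIter K n y B := fun n =>
    (Measure.measurable_coe hB).comp (measurable_kIter hK n)
  simp only [Aker, Measure.sum_apply _ hB]
  rw [tsum_eq_zero_add' ENNReal.summable, lintegral_tsum fun n => (hmeas n).aemeasurable]
  simp only [kIter, Measure.bind_apply hB (measurable_kIter hK _).aemeasurable]

lemma lintegral_Aker (hK : Measurable K) {f : E → ℝ≥0∞} (hf : Measurable f) (x : E) :
    ∫⁻ y, f y ∂Aker K x = f x + ∫⁻ y, ∫⁻ z, f z ∂K y ∂Aker K x := by
  simp only [Aker, lintegral_sum_measure]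
  rw [tsum_eq_zero_add' ENNReal.summable]
  congr 1
  · rw [kIter, lintegral_dirac' _ hf]
  · refine tsum_congr fun n => ?_
    rw [kIter_add hK, kIter_one, Measure.lintegral_bind hK.aemeasurable hf.aemeasurable]

lemma lintegral_bind_Aker (hK : Measurable K) (μ : Measure E) {f : E → ℝ≥0∞}
    (hf : Measurable f) : ∫⁻ y, f y ∂μ.bind (Aker K)
      = ∫⁻ y, f y ∂μ + ∫⁻ y, ∫⁻ z, f z ∂K y ∂μ.bind (Aker K) := by
  have hA := measurable_Aker hK
  have hKf : Measurable fun y => ∫⁻ z, f z ∂K y := (Measure.measurable_lintegral hf).comp hK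
  rw [Measure.lintegral_bind hA.aemeasurable hf.aemeasurable,
    Measure.lintegral_bind hA.aemeasurable hKf.aemeasurable, ← lintegral_add_left hf]
  exact lintegral_congr fun x => lintegral_Aker hK hf x

lemma bind_Aker_resolvent {K₁ K₂ : E → Measure E} (hK₁ : Measurable K₁) (hK₂ : Measurable K₂)
    (μ : Measure E) {B : Set E} (hB : MeasurableSet B) :
    μ.bind (Aker K₁) B + ∫⁻ y, ∫⁻ z, Aker K₂ z B ∂K₂ y ∂μ.bind (Aker K₁)
      = ∫⁻ y, Aker K₂ y B ∂μ + ∫⁻ y, ∫⁻ z, Aker K₂ z B ∂K₁ y ∂μ.bind (Aker K₁) := by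
  have hb : Measurable fun y => Aker K₂ y B :=
    (Measure.measurable_coe hB).comp (measurable_Aker hK₂)
  rw [← lintegral_bind_Aker hK₁ μ hb, lintegral_congr fun y => Aker_apply_eq hK₂ hB y,
    lintegral_add_left (f := fun y => Measure.dirac y B)
      ((Measure.measurable_coe hB).comp Measure.measurable_dirac)]
  congr 1
  simp only [Measure.dirac_apply' _ hB]
  rw [lintegral_indicator_one hB]

lemma bind_Aker_univ_le (hK : Measurable K) {M : ℝ≥0∞} (hM : ∀ x, Aker K x Set.univ ≤ M)
    (μ : Measure E) [IsProbabilityMeasure μ] : μ.bind (Aker K) Set.univ ≤ M := by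
  rw [Measure.bind_apply MeasurableSet.univ (measurable_Aker hK).aemeasurable]
  exact (lintegral_mono hM).trans (by simp)

lemma one_le_bind_Aker_univ (hK : Measurable K) (μ : Measure E) [IsProbabilityMeasure μ] :
    1 ≤ μ.bind (Aker K) Set.univ := by
  rw [Measure.bind_apply MeasurableSet.univ (measurable_Aker hK).aemeasurable]
  exact le_trans (by simp) (lintegral_mono (one_le_Aker_univ K))

lemma isProbabilityMeasure_Pim (hK : Measurable K) {M : ℝ≥0∞} (hM_top : M ≠ ⊤)
    (hM : ∀ x, Aker K x Set.univ ≤ M) (μ : Measure E) [IsProbabilityMeasure μ] :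
    IsProbabilityMeasure (Pim K μ) := ⟨by
  rw [Pim, Measure.smul_apply, smul_eq_mul]
  exact ENNReal.inv_mul_cancel
    (zero_lt_one.trans_le (one_le_bind_Aker_univ hK μ)).ne'
    (ne_top_of_le_ne_top hM_top (bind_Aker_univ_le hK hM μ))⟩

lemma abs_bind_Aker_sub_le {K₁ K₂ : E → Measure E} (hK₁ : Measurable K₁) (hK₂ : Measurable K₂)
    (hsub₁ : ∀ x, K₁ x Set.univ ≤ 1) (hsub₂ : ∀ x, K₂ x Set.univ ≤ 1) {M : ℝ} (hM : 0 ≤ M)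
    (hA₁ : ∀ x, Aker K₁ x Set.univ ≤ ENNReal.ofReal M)
    (hA₂ : ∀ x, Aker K₂ x Set.univ ≤ ENNReal.ofReal M)
    (μ ν : Measure E) [IsProbabilityMeasure μ] [IsProbabilityMeasure ν] {δ : ℝ}
    (hδ : ∀ x, tvDist (K₁ x) (K₂ x) ≤ δ) {B : Set E} (hB : MeasurableSet B) :
    |(μ.bind (Aker K₁)).real B - (ν.bind (Aker K₂)).real B| ≤ M * tvDist μ ν + M * δ * M := by
  have hfin₁ : ∀ x, IsFiniteMeasure (K₁ x) := fun x => ⟨(hsub₁ x).trans_lt ENNReal.one_lt_top⟩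
  have hfin₂ : ∀ x, IsFiniteMeasure (K₂ x) := fun x => ⟨(hsub₂ x).trans_lt ENNReal.one_lt_top⟩
  set α := μ.bind (Aker K₁)
  have hα : α Set.univ ≤ ENNReal.ofReal M := bind_Aker_univ_le hK₁ hA₁ μ
  have hαfin : IsFiniteMeasure α := ⟨hα.trans_lt ENNReal.ofReal_lt_top⟩
  let b : E → ℝ≥0∞ := fun y => Aker K₂ y B
  have hb : Measurable b := (Measure.measurable_coe hB).comp (measurable_Aker hK₂)
  have hb_le : ∀ y, b y ≤ ENNReal.ofReal M := fun y =>
    (measure_mono (Set.subset_univ B)).trans (hA₂ y)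
  have hb_top : ∀ y, b y < ⊤ := fun y => (hb_le y).trans_lt ENNReal.ofReal_lt_top
  have hr_le : ∀ y, (b y).toReal ≤ M := fun y => ENNReal.toReal_le_of_le_ofReal hM (hb_le y)
  have htoReal : ∀ m : Measure E, ∫ y, (b y).toReal ∂m = (∫⁻ y, b y ∂m).toReal := fun m =>
    integral_toReal hb.aemeasurable (Eventually.of_forall hb_top)
  have hbint : ∀ m : Measure E, m Set.univ ≤ 1 → ∫⁻ y, b y ∂m ≤ ENNReal.ofReal M := fun m hm =>
    calc ∫⁻ y, b y ∂m ≤ ∫⁻ _, ENNReal.ofReal M ∂m := lintegral_mono hb_le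
      _ = ENNReal.ofReal M * m Set.univ := lintegral_const _
      _ ≤ ENNReal.ofReal M * 1 := by gcongr
      _ = ENNReal.ofReal M := mul_one _
  have hstep : ∀ {K : E → Measure E}, Measurable K → (∀ x, K x Set.univ ≤ 1) →
      (∫⁻ y, ∫⁻ z, b z ∂K y ∂α ≠ ⊤) ∧ Integrable (fun y => ∫ z, (b z).toReal ∂K y) α ∧
      ∫ y, ∫ z, (b z).toReal ∂K y ∂α = (∫⁻ y, ∫⁻ z, b z ∂K y ∂α).toReal := by
    intro K hK hsub
    have hm : Measurable fun y => ∫⁻ z, b z ∂K y := (Measure.measurable_lintegral hb).comp hK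
    have hne : ∫⁻ y, ∫⁻ z, b z ∂K y ∂α ≠ ⊤ := by
      refine ne_top_of_le_ne_top ?_ (lintegral_mono fun y => hbint (K y) (hsub y))
      rw [lintegral_const]
      exact ENNReal.mul_ne_top ENNReal.ofReal_ne_top (measure_ne_top _ _)
    simp only [htoReal]
    exact ⟨hne, integrable_toReal_of_lintegral_ne_top hm.aemeasurable hne,
      integral_toReal hm.aemeasurable (Eventually.of_forall fun y =>
        (hbint (K y) (hsub y)).trans_lt ENNReal.ofReal_lt_top)⟩
  obtain ⟨hne₁, hint₁, heq₁⟩ := hstep hK₁ hsub₁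
  obtain ⟨hne₂, hint₂, heq₂⟩ := hstep hK₂ hsub₂
  have hμne : ∫⁻ y, b y ∂μ ≠ ⊤ :=
    ne_top_of_le_ne_top ENNReal.ofReal_ne_top (hbint μ prob_le_one)
  have hres := congrArg ENNReal.toReal (bind_Aker_resolvent hK₁ hK₂ μ hB)
  rw [ENNReal.toReal_add (measure_ne_top _ _) hne₂, ENNReal.toReal_add hμne hne₁, ← heq₁, ← heq₂,
    ← htoReal] at hres
  have hν : (ν.bind (Aker K₂)).real B = ∫ y, (b y).toReal ∂ν := by
    rw [htoReal, measureReal_def, Measure.bind_apply hB (measurable_Aker hK₂).aemeasurable]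
  have hdecomp : α.real B - (ν.bind (Aker K₂)).real B
      = (∫ y, (b y).toReal ∂μ - ∫ y, (b y).toReal ∂ν)
        + ∫ y, (∫ z, (b z).toReal ∂K₁ y - ∫ z, (b z).toReal ∂K₂ y) ∂α := by
    rw [integral_sub hint₁ hint₂, hν, measureReal_def]
    linarith
  have htest : ∀ (m n : Measure E) [IsFiniteMeasure m] [IsFiniteMeasure n],
      |∫ y, (b y).toReal ∂m - ∫ y, (b y).toReal ∂n| ≤ M * tvDist m n := fun m n _ _ =>
    abs_integral_sub_le_tvDist m n hb.ennreal_toReal (fun _ => ENNReal.toReal_nonneg) hM hr_le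
  have hpert : |∫ y, (∫ z, (b z).toReal ∂K₁ y - ∫ z, (b z).toReal ∂K₂ y) ∂α|
      ≤ M * δ * α.real Set.univ := by
    rw [← Real.norm_eq_abs]
    exact norm_integral_le_of_norm_le_const (Eventually.of_forall fun y =>
      (htest (K₁ y) (K₂ y)).trans (mul_le_mul_of_nonneg_left (hδ y) hM))
  have hδ0 : 0 ≤ δ := by
    obtain ⟨x⟩ := nonempty_of_isProbabilityMeasure μ
    exact (abs_nonneg _).trans
      ((abs_measureReal_sub_le_tvDist (K₁ x) (K₂ x) MeasurableSet.empty).trans (hδ x))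
  have hαM : α.real Set.univ ≤ M := ENNReal.toReal_le_of_le_ofReal hM hα
  rw [hdecomp]
  refine (abs_add_le _ _).trans (add_le_add (htest μ ν) (hpert.trans ?_))
  gcongr

lemma tvDist_Pim_le {K₁ K₂ : E → Measure E} (hK₁ : Measurable K₁) (hK₂ : Measurable K₂)
    (hsub₁ : ∀ x, K₁ x Set.univ ≤ 1) (hsub₂ : ∀ x, K₂ x Set.univ ≤ 1) {M : ℝ} (hM : 0 ≤ M)
    (hA₁ : ∀ x, Aker K₁ x Set.univ ≤ ENNReal.ofReal M)
    (hA₂ : ∀ x, Aker K₂ x Set.univ ≤ ENNReal.ofReal M)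
    (μ ν : Measure E) [IsProbabilityMeasure μ] [IsProbabilityMeasure ν] {δ : ℝ}
    (hδ : ∀ x, tvDist (K₁ x) (K₂ x) ≤ δ) :
    tvDist (Pim K₁ μ) (Pim K₂ ν) ≤ 2 * (M * tvDist μ ν + M * δ * M) := by
  refine tvDist_le fun B hB => ?_
  have hdiff := fun {B : Set E} (hB : MeasurableSet B) =>
    abs_bind_Aker_sub_le hK₁ hK₂ hsub₁ hsub₂ hM hA₁ hA₂ μ ν hδ hB
  simp only [Pim, measureReal_ennreal_smul_apply, ENNReal.toReal_inv, ← measureReal_def]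
  have hα : μ.bind (Aker K₁) Set.univ ≠ ⊤ :=
    ne_top_of_le_ne_top ENNReal.ofReal_ne_top (bind_Aker_univ_le hK₁ hA₁ μ)
  have hβ : ν.bind (Aker K₂) Set.univ ≠ ⊤ :=
    ne_top_of_le_ne_top ENNReal.ofReal_ne_top (bind_Aker_univ_le hK₂ hA₂ ν)
  have hβfin : IsFiniteMeasure (ν.bind (Aker K₂)) := ⟨hβ.lt_top⟩
  set a := (μ.bind (Aker K₁)).real Set.univ with ha_def
  set b := (ν.bind (Aker K₂)).real Set.univ with hb_def
  have ha : 1 ≤ a := by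
    simpa [a, b, measureReal_def] using ENNReal.toReal_mono hα (one_le_bind_Aker_univ hK₁ μ)
  have hb : 1 ≤ b := by
    simpa [a, b, measureReal_def] using ENNReal.toReal_mono hβ (one_le_bind_Aker_univ hK₂ ν)
  have h1 := hdiff hB
  have h2 := hdiff MeasurableSet.univ
  rw [← ha_def, ← hb_def] at h2
  set p := (μ.bind (Aker K₁)).real B
  set q := (ν.bind (Aker K₂)).real B
  set D := M * tvDist μ ν + M * δ * M
  have hD : 0 ≤ D := (abs_nonneg _).trans h1
  have hq0 : 0 ≤ q := measureReal_nonneg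
  have hqb : q ≤ b := measureReal_mono (Set.subset_univ B)
  have hratio : q / b ≤ 1 := (div_le_one (by linarith)).mpr hqb
  have hratio0 : 0 ≤ q / b := by positivity
  have heq : a⁻¹ * p - b⁻¹ * q = a⁻¹ * ((p - q) + q / b * (b - a)) := by
    field_simp
    ring
  have hinv : a⁻¹ ≤ 1 := inv_le_one_of_one_le₀ ha
  rw [heq, abs_mul, abs_of_nonneg (by positivity : (0 : ℝ) ≤ a⁻¹)]
  calc a⁻¹ * |p - q + q / b * (b - a)| ≤ 1 * |p - q + q / b * (b - a)| := by gcongr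
    _ ≤ |p - q| + q / b * |b - a| := by
        rw [one_mul]
        refine (abs_add_le _ _).trans (le_of_eq ?_)
        rw [abs_mul, abs_of_nonneg hratio0]
    _ ≤ D + 1 * D := by
        rw [abs_sub_comm b a]
        gcongr
    _ = 2 * D := by ring

end Resolvent

end QSD

/-- Lemma 5.1 (ii): under (H0), (H1), (H2), the ODE `dν/dt = −ν + Π_ν` on
`P(E)` admits, for every initial condition `ν₀`, a solution, and any two solutions agree
at all times `t ≥ 0`. -/
theorem stmt14
    {E : Type*} [TopologicalSpace E] [PolishSpace E] [MeasurableSpace E] [BorelSpace E]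
    (K : ProbabilityMeasure E → E → Measure E)
    (hKmeas : ∀ μ, Measurable (K μ))
    (hKsub : ∀ μ x, K μ x Set.univ ≤ 1)
    -- (H0)
    (ℓ : ℕ) (hℓ : 1 ≤ ℓ) (ρ : ℝ≥0∞) (hρ : ρ < 1)
    (hH0 : ∀ (μ : ProbabilityMeasure E) (x : E), kIter (K μ) ℓ x Set.univ ≤ ρ)
    -- (H1)
    (hFeller : ∀ (μ : ProbabilityMeasure E) (f : BoundedContinuousFunction E ℝ),
      Continuous fun x => ∫ y, f y ∂(K μ x))
    (hWCont : ∀ f : BoundedContinuousFunction E ℝ,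
      Continuous fun μ : ProbabilityMeasure E => ∫ y, f y ∂((μ : Measure E).bind (K μ)))
    -- (H2)
    (C : ℝ) (hC : 0 < C)
    (hH2 : ∀ (μ ν : ProbabilityMeasure E) (x : E),
      tvDist (K μ x) (K ν x) ≤ C * tvDist (μ : Measure E) (ν : Measure E)) :
    ∀ ν₀ : ProbabilityMeasure E,
      (∃ ν : ℝ → ProbabilityMeasure E, IsODESol K ν₀ ν) ∧
      (∀ ν ν' : ℝ → ProbabilityMeasure E, IsODESol K ν₀ ν → IsODESol K ν₀ ν' →
        ∀ t : ℝ, 0 ≤ t → ν t = ν' t) := by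
  set M : ℝ := (ℓ * (1 - ρ)⁻¹ : ℝ≥0∞).toReal
  have hM : 0 ≤ M := ENNReal.toReal_nonneg
  have hA : ∀ (μ : ProbabilityMeasure E) (x : E),
      Aker (K μ) x Set.univ ≤ ENNReal.ofReal M := fun μ x => by
    have hne : (ℓ * (1 - ρ)⁻¹ : ℝ≥0∞) ≠ ⊤ :=
      ENNReal.mul_ne_top (ENNReal.natCast_ne_top ℓ) (ENNReal.inv_ne_top.mpr (tsub_pos_of_lt hρ).ne')
    rw [ENNReal.ofReal_toReal hne]
    exact Aker_univ_le (hKmeas μ) (hKsub μ) hℓ (hH0 μ) x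
  have hprob : ∀ μ : ProbabilityMeasure E, IsProbabilityMeasure (Pim (K μ) (μ : Measure E)) :=
    fun μ => isProbabilityMeasure_Pim (hKmeas μ) ENNReal.ofReal_ne_top (hA μ) _
  let ι : ProbabilityMeasure E → SetFun E := fun μ => toSetFun (μ : Measure E)
  have hι : Function.Injective ι := toSetFun_injective
  let P : SetFun E → SetFun E :=
    Function.extend ι (fun μ => ι ⟨Pim (K μ) (μ : Measure E), hprob μ⟩) 0
  have hPι : ∀ μ, P (ι μ) = ι ⟨Pim (K μ) (μ : Measure E), hprob μ⟩ := hι.extend_apply _ _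
  set L : ℝ := 2 * (M + M * C * M) + 1
  have hL : 0 < L := by positivity
  have hP : ∀ x ∈ Set.range ι, ∀ y ∈ Set.range ι, ‖P x - P y‖ ≤ L * ‖x - y‖ := by
    rintro _ ⟨μ, rfl⟩ _ ⟨ν, rfl⟩
    have h := tvDist_Pim_le (hKmeas μ) (hKmeas ν) (hKsub μ) (hKsub ν) hM (hA μ) (hA ν)
      (μ : Measure E) (ν : Measure E) (hH2 μ ν)
    have h0 : ‖ι μ - ι ν‖ = tvDist (μ : Measure E) (ν : Measure E) := norm_toSetFun_sub _ _
    have h1 : ‖P (ι μ) - P (ι ν)‖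
        = tvDist (Pim (K μ) (μ : Measure E)) (Pim (K ν) (ν : Measure E)) := by
      rw [hPι, hPι]
      exact norm_toSetFun_sub (Pim (K μ) (μ : Measure E)) (Pim (K ν) (ν : Measure E))
    rw [← h1, ← h0] at h
    refine h.trans ?_
    have := norm_nonneg (ι μ - ι ν)
    simp only [L]
    linarith
  have hPS : ∀ x ∈ Set.range ι, P x ∈ Set.range ι := by
    rintro _ ⟨μ, rfl⟩
    exact ⟨_, (hPι μ).symm⟩
  have hbdd : ∀ x ∈ Set.range ι, ‖x‖ ≤ 1 := by
    rintro _ ⟨μ, rfl⟩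
    exact norm_toSetFun_le_one μ
  have heval : ∀ {u : ℝ → SetFun E} {ν : ℝ → ProbabilityMeasure E}, Continuous u →
      (∀ s, u s ∈ Set.range ι) → (∀ s, 0 ≤ s → u s = ι (ν s)) → ∀ t, 0 ≤ t →
      ∀ (A : Set E) (hA : MeasurableSet A),
      (∫ s in (0 : ℝ)..t, (P (u s) - u s) : SetFun E) ⟨A, hA⟩ = ∫ s in Set.Ioc (0 : ℝ) t,
        ((Pim (K (ν s)) (ν s : Measure E) A).toReal - ((ν s : Measure E) A).toReal) := by
    intro u ν hu huS huν t ht A hA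
    have hint : IntervalIntegrable (fun s => P (u s) - u s) volume 0 t :=
      ((continuous_comp_of_lipschitz hP hu huS).sub hu).intervalIntegrable _ _
    have hcomm := (lp.evalCLM ℝ (fun _ : {s : Set E // MeasurableSet s} => ℝ) ∞
      ⟨A, hA⟩).intervalIntegral_comp_comm hint
    refine hcomm.symm.trans ?_
    rw [intervalIntegral.integral_of_le ht]
    refine setIntegral_congr_fun measurableSet_Ioc fun s hs => ?_
    simp only [huν s hs.1.le, hPι]
    rfl
  intro ν₀
  have hcurve : ∀ {ν : ℝ → ProbabilityMeasure E}, IsODESol K ν₀ ν →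
      Continuous (fun t => ι (ν (max t 0))) ∧ ∀ t, 0 ≤ t → ι (ν (max t 0))
        = ι ν₀ + ∫ s in (0 : ℝ)..t, (P (ι (ν (max s 0))) - ι (ν (max s 0))) := by
    rintro ν ⟨-, ⟨L', hL'⟩, hint⟩
    have hcont : Continuous fun t => ι (ν (max t 0)) := by
      refine (LipschitzWith.of_dist_le' (K := |L'|) fun s t => ?_).continuous
      rw [dist_eq_norm, Real.dist_eq]
      have h0 : ‖ι (ν (max s 0)) - ι (ν (max t 0))‖
          = tvDist (ν (max s 0) : Measure E) (ν (max t 0) : Measure E) := norm_toSetFun_sub _ _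
      rw [h0]
      calc _ ≤ L' * |max s 0 - max t 0| := hL' _ _ (le_max_right _ _) (le_max_right _ _)
        _ ≤ |L'| * |s - t| :=
          mul_le_mul (le_abs_self L') (abs_max_sub_max_le_abs s t 0) (abs_nonneg _) (abs_nonneg _)
    refine ⟨hcont, fun t ht => ?_⟩
    ext A
    have h := heval (ν := ν) hcont (fun s => ⟨_, rfl⟩) (fun s hs => by simp only [max_eq_left hs]) t ht
      A.1 A.2
    rw [max_eq_left ht, lp.coeFn_add, Pi.add_apply, h]
    exact hint t ht A.1 A.2
  refine ⟨?_, fun ν ν' hν hν' t ht => ?_⟩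
  · obtain ⟨u, hu, huS, hu_int⟩ := exists_integral_solution convex_range_toSetFun
      isClosed_range_toSetFun hbdd hL hP hPS (x₀ := ι ν₀) ⟨ν₀, rfl⟩
    choose ν hν using huS
    refine ⟨ν, hι ?_, ⟨2, fun s t hs ht => ?_⟩, fun t ht A hA => ?_⟩
    · have h0 : ι (ν 0) = u 0 := hν 0
      rw [h0, hu_int 0 le_rfl]
      simp
    · have hint : ∀ a b, IntervalIntegrable (fun s => P (u s) - u s) volume a b := fun a b =>
        ((continuous_comp_of_lipschitz hP hu fun s => ⟨ν s, hν s⟩).sub hu).intervalIntegrable _ _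
      have h0 : tvDist (ν s : Measure E) (ν t : Measure E) = ‖u s - u t‖ := by
        rw [← hν s, ← hν t]
        exact (norm_toSetFun_sub _ _).symm
      rw [h0, hu_int s hs, hu_int t ht, add_sub_add_left_eq_sub,
        intervalIntegral.integral_interval_sub_left (hint _ _) (hint _ _)]
      refine intervalIntegral.norm_integral_le_of_norm_le_const fun r _ => ?_
      have hr : u r ∈ Set.range ι := ⟨ν r, hν r⟩
      linarith [norm_sub_le (P (u r)) (u r), hbdd _ hr, hbdd _ (hPS _ hr)]
    · have h := congrArg (fun x : SetFun E => x ⟨A, hA⟩) (hu_int t ht)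
      simp only [lp.coeFn_add, Pi.add_apply] at h
      rw [heval hu (fun s => ⟨ν s, hν s⟩) (fun s _ => (hν s).symm) t ht A hA, ← hν t] at h
      exact h
  · obtain ⟨hc, hi⟩ := hcurve hν
    obtain ⟨hc', hi'⟩ := hcurve hν'
    have h := integral_solution_unique hP hc hc' (fun _ => ⟨_, rfl⟩) (fun _ => ⟨_, rfl⟩) hi hi' ht
    simp only [max_eq_left ht] at h
    exact hι h
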